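/- arXiv:1205.2948 — 2 statements merged into one kernel-verified Lean document; each statement's English description precedes it below -/
import Mathlib

section
/- Assume the non-degeneracy condition P(a_1 ≤ r, b_1 ≤ r) + P(a_1 > r, b_1 > r) ≠ 0, so that δ := E|W_1| < 1, and let m be the unique nonnegative integer with m·d < max(d, q+1) ≤ (m+1)·d. Then for every n ∈ ℤ, Σ_{j=1}^∞ E| (∏_{i=0}^{j−1} W_{n−id}) · U_{n−jd} | ≤ Σ_{j=1}^∞ δ^{⌊(j−1)/(m+1)⌋} = (m+1)·Σ_{k=0}^∞ δ^k < ∞. -/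
open MeasureTheory ProbabilityTheory Filter Finset

/-- If a doubly indexed family of random variables is independent, then so are its rows. -/
lemma iIndepFun_curry {Ω ι κ 𝓧 : Type*} {mΩ : MeasurableSpace Ω} {m𝓧 : MeasurableSpace 𝓧}
    {P : Measure Ω} {X : ι → κ → Ω → 𝓧} (mX : ∀ i j, Measurable (X i j))
    (h : iIndepFun (fun (p : ι × κ) ω ↦ X p.1 p.2 ω) P) :
    iIndepFun (fun i ω j ↦ X i j ω) P := by
  have := h.isProbabilityMeasure
  have : ∀ i j, IsProbabilityMeasure (P.map (X i j)) :=
    fun i j ↦ Measure.isProbabilityMeasure_map (mX i j).aemeasurable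
  have hrow (i : ι) : iIndepFun (X i) P :=
    h.precomp (g := fun j ↦ (i, j)) (Prod.mk_right_injective i)
  have hcurry : (MeasurableEquiv.curry ι κ 𝓧) ∘ (fun ω p ↦ X p.1 p.2 ω) =
      fun ω i j ↦ X i j ω := rfl
  rw [iIndepFun_iff_map_fun_eq_infinitePi_map (by fun_prop), ← hcurry,
    ← Measure.map_map (by fun_prop) (by fun_prop),
    (iIndepFun_iff_map_fun_eq_infinitePi_map (by fun_prop)).1 h,
    Measure.infinitePi_map_curry (fun i j ↦ P.map (X i j))]
  congr with i : 1
  rw [(iIndepFun_iff_map_fun_eq_infinitePi_map (by fun_prop)).1 (hrow i)]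

section Window

variable {Ω : Type*} {mΩ : MeasurableSpace Ω} {P : Measure Ω} {e : ℤ → Ω → ℝ}

/-- The law of a window of `q + 1` consecutive terms of an i.i.d. sequence does not depend on the
position of the window. -/
lemma map_window_eq (he : ∀ n, Measurable (e n)) (hindep : iIndepFun e P)
    (hident : ∀ n, P.map (e n) = P.map (e 0)) (q : ℕ) (k l : ℤ) :
    P.map (fun ω (i : Fin (q + 1)) ↦ e (k - (i : ℕ)) ω) =
      P.map (fun ω (i : Fin (q + 1)) ↦ e (l - (i : ℕ)) ω) := by
  have := hindep.isProbabilityMeasure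
  have key (k : ℤ) : P.map (fun ω (i : Fin (q + 1)) ↦ e (k - (i : ℕ)) ω) =
      Measure.pi fun _ ↦ P.map (e 0) := by
    have hk : iIndepFun (fun i : Fin (q + 1) ↦ e (k - (i : ℕ))) P :=
      hindep.precomp (g := fun i : Fin (q + 1) ↦ k - ((i : ℕ) : ℤ)) fun i j hij ↦ by
        simp only at hij
        omega
    rw [(iIndepFun_iff_map_fun_eq_pi_map fun i ↦ (he _).aemeasurable).1 hk]
    simp_rw [hident]
  rw [key, key]

/-- Windows of length `q + 1` at spacing `L ≥ q + 1` in an independent sequence are independent. -/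
lemma iIndepFun_window (he : ∀ n, Measurable (e n)) (hindep : iIndepFun e P) {q L : ℕ}
    (hL : q + 1 ≤ L) (n : ℤ) :
    iIndepFun (fun (k : ℕ) ω (i : Fin (q + 1)) ↦ e (n - k * L - (i : ℕ)) ω) P := by
  refine iIndepFun_curry (X := fun (k : ℕ) (i : Fin (q + 1)) ↦ e (n - k * L - (i : ℕ)))
    (fun _ _ ↦ he _) ?_
  refine hindep.precomp (g := fun p : ℕ × Fin (q + 1) ↦ n - p.1 * L - ((p.2 : ℕ) : ℤ)) ?_
  rintro ⟨k, i⟩ ⟨k', i'⟩ h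
  simp only at h
  have h' : k * L + i = k' * L + i' := by
    zify
    linarith
  have hi : (i : ℕ) < L := i.2.trans_le hL
  have hi' : (i' : ℕ) < L := i'.2.trans_le hL
  have hmod : (i : ℕ) = i' := by
    simpa [Nat.add_mod, Nat.mod_eq_of_lt hi, Nat.mod_eq_of_lt hi'] using
      congrArg (· % L) h'
  have hk : k = k' := by
    rw [hmod] at h'
    exact Nat.eq_of_mul_eq_mul_right (by omega) (Nat.add_right_cancel h')
  exact Prod.ext hk (Fin.ext hmod)

/-- The expectation of a product of a function of separated windows of an i.i.d. sequence
is a power. -/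
lemma integral_prod_window (he : ∀ n, Measurable (e n)) (hindep : iIndepFun e P)
    (hident : ∀ n, P.map (e n) = P.map (e 0)) {q L : ℕ} (hL : q + 1 ≤ L)
    {g : (Fin (q + 1) → ℝ) → ℝ} (hg : Measurable g) (n l : ℤ) (N : ℕ) :
    ∫ ω, ∏ k ∈ range N, g (fun i ↦ e (n - k * L - (i : ℕ)) ω) ∂P =
      (∫ ω, g (fun i ↦ e (l - (i : ℕ)) ω) ∂P) ^ N := by
  have hind : iIndepFun (fun (k : Fin N) ω (i : Fin (q + 1)) ↦
      e (n - (k : ℕ) * L - (i : ℕ)) ω) P :=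
    (iIndepFun_window he hindep hL n).precomp (g := fun k : Fin N ↦ (k : ℕ)) Fin.val_injective
  have hX (k : ℤ) : Measurable fun ω (i : Fin (q + 1)) ↦ e (k - (i : ℕ)) ω :=
    measurable_pi_lambda _ fun _ ↦ he _
  simp_rw [← Fin.prod_univ_eq_prod_range
    (fun k : ℕ ↦ g (fun i : Fin (q + 1) ↦ e (n - k * L - (i : ℕ)) _)) N]
  rw [hind.integral_fun_prod_comp (f := fun _ ↦ g) (fun k ↦ (hX _).aemeasurable)
    fun k ↦ hg.aestronglyMeasurable]
  have hstat (k : ℤ) : ∫ ω, g (fun i ↦ e (k - (i : ℕ)) ω) ∂P =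
      ∫ ω, g (fun i ↦ e (l - (i : ℕ)) ω) ∂P := by
    rw [← integral_map (hX k).aemeasurable hg.aestronglyMeasurable,
      ← integral_map (hX l).aemeasurable hg.aestronglyMeasurable,
      map_window_eq he hindep hident q k l]
  simp [hstat]

end Window

/-- A product of numbers in `[0, 1]` is at most the product along the multiples of `m + 1`. -/
lemma prod_range_le_prod_multiples {f : ℕ → ℝ} (h0 : ∀ i, 0 ≤ f i) (h1 : ∀ i, f i ≤ 1)
    (m j : ℕ) :
    ∏ i ∈ range (j + 1), f i ≤ ∏ k ∈ range (j / (m + 1) + 1), f (k * (m + 1)) := by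
  have hinj : Set.InjOn (fun k ↦ k * (m + 1)) (range (j / (m + 1) + 1)) :=
    (mul_left_injective₀ m.succ_ne_zero).injOn
  rw [← prod_image (f := f) hinj]
  refine prod_le_prod_of_subset_of_le_one ?_ (fun i _ ↦ h0 i) fun i _ _ ↦ h1 i
  intro i hi
  obtain ⟨k, hk, rfl⟩ := mem_image.1 hi
  rw [mem_range, Nat.lt_succ_iff] at hk ⊢
  exact (Nat.le_div_iff_mul_le m.succ_pos).1 hk

/-- The geometric series in which each term is repeated `m + 1` times. -/
lemma hasSum_pow_div {δ : ℝ} (h0 : 0 ≤ δ) (h1 : δ < 1) (m : ℕ) :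
    HasSum (fun j : ℕ ↦ δ ^ (j / (m + 1))) ((m + 1) * ∑' k : ℕ, δ ^ k) := by
  have hs := summable_geometric_of_lt_one h0 h1
  have hc : HasSum (fun _ : Fin (m + 1) ↦ (1 : ℝ)) (m + 1) := by
    simpa using hasSum_fintype (fun _ : Fin (m + 1) ↦ (1 : ℝ))
  have h := hs.hasSum.mul hc (hs.mul_of_nonneg hc.summable (fun k ↦ pow_nonneg h0 k)
    fun _ ↦ zero_le_one)
  rw [mul_comm, ← (Nat.divModEquiv (m + 1)).hasSum_iff] at h
  simpa [Function.comp_def, Nat.divModEquiv] using h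

/-- A random variable with values in `[0, 1]` that vanishes on a non-null set has expectation
less than one. -/
lemma integral_lt_one_of_eq_zero {Ω : Type*} {mΩ : MeasurableSpace Ω} {P : Measure Ω}
    [IsProbabilityMeasure P] {f : Ω → ℝ} (hf : Integrable f P) (h1 : ∀ ω, f ω ≤ 1)
    {s : Set Ω} (hs : P s ≠ 0) (hfs : ∀ ω ∈ s, f ω = 0) : ∫ ω, f ω ∂P < 1 := by
  have hpos : 0 < ∫ ω, (1 - f ω) ∂P := by
    rw [integral_pos_iff_support_of_nonneg (fun ω ↦ sub_nonneg.2 (h1 ω))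
      ((integrable_const 1).sub hf)]
    refine (pos_iff_ne_zero.2 hs).trans_le (measure_mono fun ω hω ↦ ?_)
    simp [hfs ω hω]
  rw [integral_sub (integrable_const 1) hf] at hpos
  simpa using hpos

/-- Under the non-degeneracy condition (so that `δ := E|W₁| < 1`),
with `m` the unique nonnegative integer such that `m·d < max(d, q+1) ≤ (m+1)·d`,
for every `n ∈ ℤ`,
`Σ_{j=1}^∞ E|(∏_{i=0}^{j−1} W_{n−id})·U_{n−jd}| ≤ Σ_{j=1}^∞ δ^{⌊(j−1)/(m+1)⌋}
  = (m+1)·Σ_{k=0}^∞ δ^k < ∞`.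
(The series over `j ≥ 1` is reindexed by `j = j' + 1`, `j' : ℕ`, so that
`⌊(j−1)/(m+1)⌋ = j'/(m+1)` in natural-number division.) -/
theorem tma_series_of_moments_summable
    {Ω : Type*} [MeasureSpace Ω] [IsProbabilityMeasure (ℙ : Measure Ω)]
    (e : ℤ → Ω → ℝ)
    (he : ∀ n, Measurable (e n))
    (hindep : iIndepFun e ℙ)
    (hident : ∀ n, Measure.map (e n) ℙ = Measure.map (e 0) ℙ)
    (q d : ℕ) (hq : 0 < q) (hd : 0 < d)
    (r μ1 μ2 : ℝ) (φ ψ : ℕ → ℝ)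
    (a b U W : ℤ → Ω → ℝ)
    (ha : ∀ n ω, a n ω = μ2 + e n ω + ∑ i ∈ Finset.Icc 1 q, ψ i * e (n - i) ω)
    (hb : ∀ n ω, b n ω = μ1 + e n ω + ∑ i ∈ Finset.Icc 1 q, φ i * e (n - i) ω)
    (hU : ∀ n ω, U n ω = if a n ω ≤ r then 1 else 0)
    (hW : ∀ n ω, W n ω = (if b n ω ≤ r then 1 else 0) - (if a n ω ≤ r then 1 else 0))
    (hnd : ℙ {ω | a 1 ω ≤ r ∧ b 1 ω ≤ r} + ℙ {ω | r < a 1 ω ∧ r < b 1 ω} ≠ 0)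
    (m : ℕ) (hm1 : m * d < max d (q + 1)) (hm2 : max d (q + 1) ≤ (m + 1) * d) :
    ∀ n : ℤ,
      Summable (fun j : ℕ =>
        ∫ ω, |(∏ i ∈ Finset.range (j + 1), W (n - (i : ℤ) * d) ω)
                * U (n - ((j : ℤ) + 1) * d) ω| ∂ℙ) ∧
      Summable (fun j : ℕ => (∫ ω, |W 1 ω| ∂ℙ) ^ (j / (m + 1))) ∧
      (∑' j : ℕ,
        ∫ ω, |(∏ i ∈ Finset.range (j + 1), W (n - (i : ℤ) * d) ω)
                * U (n - ((j : ℤ) + 1) * d) ω| ∂ℙ)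
        ≤ ∑' j : ℕ, (∫ ω, |W 1 ω| ∂ℙ) ^ (j / (m + 1)) ∧
      (∑' j : ℕ, (∫ ω, |W 1 ω| ∂ℙ) ^ (j / (m + 1)))
        = (m + 1) * ∑' k : ℕ, (∫ ω, |W 1 ω| ∂ℙ) ^ k := by
  have habs (n : ℤ) (ω : Ω) : |W n ω| ≤ 1 := by
    rw [hW]
    split_ifs <;> norm_num
  have hUabs (n : ℤ) (ω : Ω) : |U n ω| ≤ 1 := by
    rw [hU]
    split_ifs <;> norm_num
  let M (μ : ℝ) (c : ℕ → ℝ) (v : Fin (q + 1) → ℝ) : ℝ :=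
    μ + v 0 + ∑ i ∈ Icc 1 q, c i * v (Fin.ofNat (q + 1) i)
  have hM (μ : ℝ) (c : ℕ → ℝ) : Measurable (M μ c) := by fun_prop
  have hMe (μ : ℝ) (c : ℕ → ℝ) (n : ℤ) (ω : Ω) : M μ c (fun i ↦ e (n - (i : ℕ)) ω) =
      μ + e n ω + ∑ i ∈ Icc 1 q, c i * e (n - i) ω := by
    simp only [M, Fin.val_zero, Nat.cast_zero, sub_zero, Fin.val_ofNat]
    congr 1
    refine sum_congr rfl fun i hi ↦ ?_
    rw [Nat.mod_eq_of_lt (Nat.lt_succ_of_le (mem_Icc.1 hi).2)]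
  let g (v : Fin (q + 1) → ℝ) : ℝ :=
    |(if M μ1 φ v ≤ r then 1 else 0) - (if M μ2 ψ v ≤ r then 1 else 0)|
  have hg : Measurable g :=
    ((Measurable.ite (measurableSet_le (hM μ1 φ) measurable_const) measurable_const
      measurable_const).sub (Measurable.ite (measurableSet_le (hM μ2 ψ) measurable_const)
      measurable_const measurable_const)).abs
  have hWg (n : ℤ) (ω : Ω) : |W n ω| = g (fun i ↦ e (n - (i : ℕ)) ω) := by
    simp only [g, hMe, hW, ha, hb]
  have hWm (n : ℤ) : Measurable fun ω ↦ |W n ω| := by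
    have hwin : Measurable fun ω (i : Fin (q + 1)) ↦ e (n - (i : ℕ)) ω :=
      measurable_pi_lambda _ fun _ ↦ he _
    rw [funext (hWg n)]
    exact hg.comp hwin
  have hprod_int (s : Finset ℕ) (t : ℕ → ℤ) :
      Integrable (fun ω ↦ ∏ k ∈ s, |W (t k) ω|) ℙ := by
    refine Integrable.of_bound
      (Finset.measurable_fun_prod s fun k _ ↦ hWm (t k)).aestronglyMeasurable 1
      (ae_of_all _ fun ω ↦ ?_)
    rw [Real.norm_of_nonneg (prod_nonneg fun _ _ ↦ abs_nonneg _)]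
    exact prod_le_one (fun _ _ ↦ abs_nonneg _) fun _ _ ↦ habs _ _
  have hδ0 : 0 ≤ ∫ ω, |W 1 ω| ∂ℙ := integral_nonneg fun _ ↦ abs_nonneg _
  have hδ1 : ∫ ω, |W 1 ω| ∂ℙ < 1 := by
    have hint : Integrable (fun ω ↦ |W 1 ω|) ℙ := by
      simpa using hprod_int {0} fun _ ↦ 1
    obtain h | h : ℙ {ω | a 1 ω ≤ r ∧ b 1 ω ≤ r} ≠ 0 ∨ ℙ {ω | r < a 1 ω ∧ r < b 1 ω} ≠ 0 := by
      by_contra! h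
      exact hnd (by rw [h.1, h.2, add_zero])
    · refine integral_lt_one_of_eq_zero hint (habs 1) h fun ω hω ↦ ?_
      simp [hW, hω.1, hω.2]
    · refine integral_lt_one_of_eq_zero hint (habs 1) h fun ω hω ↦ ?_
      simp [hW, hω.1.not_ge, hω.2.not_ge]
  have hL : q + 1 ≤ (m + 1) * d := (le_max_right _ _).trans hm2
  intro n
  have hterm (j : ℕ) : ∫ ω, |(∏ i ∈ range (j + 1), W (n - (i : ℤ) * d) ω)
      * U (n - ((j : ℤ) + 1) * d) ω| ∂ℙ ≤ (∫ ω, |W 1 ω| ∂ℙ) ^ (j / (m + 1)) := by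
    calc
      _ ≤ ∫ ω, ∏ k ∈ range (j / (m + 1) + 1), |W (n - k * ((m + 1) * d : ℕ)) ω| ∂ℙ := by
        refine integral_mono_of_nonneg (ae_of_all _ fun _ ↦ abs_nonneg _) (hprod_int _ _)
          (ae_of_all _ fun ω ↦ ?_)
        simp only [abs_mul, abs_prod]
        refine (mul_le_of_le_one_right (prod_nonneg fun _ _ ↦ abs_nonneg _) (hUabs _ _)).trans ?_
        refine (prod_range_le_prod_multiples (f := fun i : ℕ ↦ |W (n - (i : ℤ) * d) ω|)
          (fun _ ↦ abs_nonneg _) (fun _ ↦ habs _ _) m j).trans_eq ?_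
        refine prod_congr rfl fun k _ ↦ ?_
        push_cast
        rw [mul_assoc]
      _ = (∫ ω, |W 1 ω| ∂ℙ) ^ (j / (m + 1) + 1) := by
        simp_rw [hWg]
        exact integral_prod_window he hindep hident hL hg n 1 _
      _ ≤ _ := pow_le_pow_of_le_one hδ0 hδ1.le (Nat.le_succ _)
  have hgeom := hasSum_pow_div hδ0 hδ1 m
  have hsum := hgeom.summable.of_nonneg_of_le
    (fun j ↦ integral_nonneg fun _ ↦ abs_nonneg _) hterm
  exact ⟨hsum, hgeom.summable, hsum.tsum_le_tsum hterm hgeom.summable, hgeom.tsum_eq⟩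
end

section
/- Assume the non-degeneracy condition P(a_1 ≤ r, b_1 ≤ r) + P(a_1 > r, b_1 > r) ≠ 0. Then the process S_n = a_n + (b_n − a_n)·α_{n−d} is a solution of the TMA(q) model: for every n ∈ ℤ, almost surely S_n = μ1 + e_n + Σ_{i=1}^q φ_i e_{n−i} when S_{n−d} ≤ r, and S_n = μ2 + e_n + Σ_{i=1}^q ψ_i e_{n−i} when S_{n−d} > r. -/
open MeasureTheory ProbabilityTheory Filter Finset

/-- A family of blocks of independent variables, the blocks using disjoint indices, is
independent. -/
theorem ProbabilityTheory.iIndepFun.curry {Ω ι κ E : Type*} [MeasurableSpace Ω] [MeasurableSpace E]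
    {P : Measure Ω} {X : ι × κ → Ω → E} (hX : iIndepFun X P) (hm : ∀ p, Measurable (X p)) :
    iIndepFun (fun i ω k ↦ X (i, k) ω) P := by
  have := hX.isProbabilityMeasure
  have hprob (p : ι × κ) : IsProbabilityMeasure (P.map (X p)) :=
    Measure.isProbabilityMeasure_map (hm p).aemeasurable
  have hrow (i : ι) :
      P.map (fun ω k ↦ X (i, k) ω) = Measure.infinitePi fun k ↦ P.map (X (i, k)) :=
    (iIndepFun_iff_map_fun_eq_infinitePi_map fun k ↦ hm (i, k)).1
      (hX.precomp (Prod.mk_right_injective i))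
  rw [iIndepFun_iff_map_fun_eq_infinitePi_map fun i ↦ measurable_pi_lambda _ fun k ↦ hm (i, k)]
  simp_rw [hrow]
  rw [← Measure.infinitePi_map_curry (μ := fun i k ↦ P.map (X (i, k)))]
  change _ = Measure.map _ (Measure.infinitePi fun p ↦ P.map (X p))
  rw [← (iIndepFun_iff_map_fun_eq_infinitePi_map hm).1 hX,
    Measure.map_map (by fun_prop) (measurable_pi_lambda _ hm)]
  rfl

/-- The law of a window of an i.i.d. sequence does not depend on the indices it uses. -/
theorem map_window_eq_pi {Ω ι κ E : Type*} [MeasurableSpace Ω] [MeasurableSpace E] [Fintype κ]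
    {P : Measure Ω} [IsProbabilityMeasure P] {e : ι → Ω → E} (he : ∀ n, Measurable (e n))
    (hindep : iIndepFun e P) {ν : Measure E} (hident : ∀ n, P.map (e n) = ν)
    {g : κ → ι} (hg : g.Injective) :
    P.map (fun ω k ↦ e (g k) ω) = Measure.pi fun _ ↦ ν := by
  rw [(iIndepFun_iff_map_fun_eq_pi_map fun k ↦ (he (g k)).aemeasurable).1 (hindep.precomp hg)]
  simp_rw [hident]

/-- Windows of an i.i.d. sequence, taken backwards at steps at least as long as the window,
almost surely visit every set which one window visits with positive probability. -/
theorem ae_exists_window_mem {Ω E : Type*} [MeasurableSpace Ω] [MeasurableSpace E]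
    {P : Measure Ω} [IsProbabilityMeasure P] {e : ℤ → Ω → E} (he : ∀ n, Measurable (e n))
    (hindep : iIndepFun e P) (hident : ∀ n, P.map (e n) = P.map (e 0))
    {N c : ℕ} (hNc : N ≤ c) {B : Set (Fin N → E)} (hB : MeasurableSet B) (m₀ : ℤ)
    (hpos : P {ω | (fun i : Fin N ↦ e (m₀ - (i : ℕ)) ω) ∈ B} ≠ 0) (m : ℤ) :
    ∀ᵐ ω ∂P, ∃ k : ℕ, (fun i : Fin N ↦ e (m - (k : ℤ) * c - (i : ℕ)) ω) ∈ B := by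
  have hinj (n : ℤ) : Function.Injective fun i : Fin N ↦ n - (i : ℕ) := fun i j h ↦ by
    ext; simpa using h
  have hmeas (n : ℤ) : Measurable fun ω (i : Fin N) ↦ e (n - (i : ℕ)) ω :=
    measurable_pi_lambda _ fun i ↦ he _
  let A : ℕ → Set Ω := fun k ↦ {ω | (fun i : Fin N ↦ e (m - (k : ℤ) * c - (i : ℕ)) ω) ∈ B}
  have hA (k : ℕ) : MeasurableSet (A k) := hmeas _ hB
  have hPA (k : ℕ) : P (A k) = P {ω | (fun i : Fin N ↦ e (m₀ - (i : ℕ)) ω) ∈ B} := by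
    have h (n : ℤ) : P {ω | (fun i : Fin N ↦ e (n - (i : ℕ)) ω) ∈ B}
        = Measure.pi (fun _ : Fin N ↦ P.map (e 0)) B := by
      rw [← map_window_eq_pi he hindep hident (hinj n), Measure.map_apply (hmeas n) hB]
      rfl
    exact (h _).trans (h _).symm
  have hpair : Function.Injective fun p : ℕ × Fin N ↦ m - (p.1 : ℤ) * c - (p.2 : ℕ) := by
    rintro ⟨k, i⟩ ⟨l, j⟩ h
    have hic : (i : ℕ) < c := i.2.trans_le hNc
    have hjc : (j : ℕ) < c := j.2.trans_le hNc
    have hc : 0 < c := by omega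
    have h' : (i : ℕ) + c * k = j + c * l := by
      zify
      simp only at h
      linarith
    have hij : (i : ℕ) = j := by
      simpa [Nat.mod_eq_of_lt hic, Nat.mod_eq_of_lt hjc] using congrArg (· % c) h'
    have hkl : k = l := Nat.eq_of_mul_eq_mul_left hc (by omega)
    exact Prod.ext hkl (Fin.ext hij)
  have hshifted := hindep.precomp hpair
  have hblocks := hshifted.curry fun p ↦ he _
  have hAindep : iIndepSet A P := (iIndepSet_iff_meas_biInter hA).2 fun s ↦
    hblocks.measure_inter_preimage_eq_mul s (sets := fun _ ↦ B) fun _ _ ↦ hB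
  have hlim : P (limsup A atTop) = 1 := measure_limsup_eq_one hA hAindep (by
    simp_rw [hPA]
    exact ENNReal.tsum_const_eq_top_of_ne_zero hpos)
  filter_upwards [(mem_ae_iff_prob_eq_one (MeasurableSet.measurableSet_limsup hA)).2 hlim] with ω hω
  exact (mem_limsup_iff_frequently_mem.1 hω).exists

/-- One step of the recursion satisfied by a series of running products, when a factor
vanishes. -/
theorem tsum_prod_mul_eq_add {w : ℕ → ℝ} (u : ℕ → ℝ) (hw : ∃ j, w j = 0) :
    ∑' j, (∏ s ∈ range j, w s) * u j =
      u 0 + w 0 * ∑' j, (∏ s ∈ range j, w (s + 1)) * u (j + 1) := by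
  obtain ⟨k, hk⟩ := hw
  have hsum : Summable fun j ↦ (∏ s ∈ range j, w s) * u j :=
    summable_of_ne_finset_zero (s := range (k + 1)) fun j hj ↦ by
      rw [prod_eq_zero (i := k) (by simp at hj ⊢; omega) hk, zero_mul]
  rw [hsum.tsum_eq_zero_add, ← tsum_mul_left]
  simp [prod_range_succ', mul_comm, mul_left_comm]

/-- A terminating series of running products is `0` or `1` when each step maps
`{0, 1}` to itself. -/
theorem tsum_prod_mul_eq_zero_or_one {w u : ℕ → ℝ} (hu : ∀ j, u j = 0 ∨ u j = 1)
    (huw : ∀ j, u j + w j = 0 ∨ u j + w j = 1) (hw : ∃ j, w j = 0) :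
    ∑' j, (∏ s ∈ range j, w s) * u j = 0 ∨ ∑' j, (∏ s ∈ range j, w s) * u j = 1 := by
  obtain ⟨k, hk⟩ := hw
  induction k generalizing w u with
  | zero => simpa [tsum_prod_mul_eq_add u ⟨0, hk⟩, hk] using hu 0
  | succ k ih =>
    rw [tsum_prod_mul_eq_add u ⟨k + 1, hk⟩]
    rcases ih (fun j ↦ hu (j + 1)) (fun j ↦ huw (j + 1)) hk with h | h
    · simpa [h] using hu 0
    · simpa [h] using huw 0

/-- Under the non-degeneracy condition, the process
`S_n = a_n + (b_n − a_n)·α_{n−d}` is a solution of the TMA(q) model: for every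
`n ∈ ℤ`, almost surely `S_n = μ1 + e_n + Σ_{i=1}^q φ_i e_{n−i}` (i.e. `S_n = b_n`)
when `S_{n−d} ≤ r`, and `S_n = μ2 + e_n + Σ_{i=1}^q ψ_i e_{n−i}` (i.e. `S_n = a_n`)
when `S_{n−d} > r`. -/
theorem tma_S_solves_model
    {Ω : Type*} [MeasureSpace Ω] [IsProbabilityMeasure (ℙ : Measure Ω)]
    (e : ℤ → Ω → ℝ)
    (he : ∀ n, Measurable (e n))
    (hindep : iIndepFun e ℙ)
    (hident : ∀ n, Measure.map (e n) ℙ = Measure.map (e 0) ℙ)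
    (q d : ℕ) (hq : 0 < q) (hd : 0 < d)
    (r μ1 μ2 : ℝ) (φ ψ : ℕ → ℝ)
    (a b U W : ℤ → Ω → ℝ)
    (ha : ∀ n ω, a n ω = μ2 + e n ω + ∑ i ∈ Finset.Icc 1 q, ψ i * e (n - i) ω)
    (hb : ∀ n ω, b n ω = μ1 + e n ω + ∑ i ∈ Finset.Icc 1 q, φ i * e (n - i) ω)
    (hU : ∀ n ω, U n ω = if a n ω ≤ r then 1 else 0)
    (hW : ∀ n ω, W n ω = (if b n ω ≤ r then 1 else 0) - (if a n ω ≤ r then 1 else 0))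
    (hnd : ℙ {ω | a 1 ω ≤ r ∧ b 1 ω ≤ r} + ℙ {ω | r < a 1 ω ∧ r < b 1 ω} ≠ 0)
    (α : ℤ → Ω → ℝ)
    (hα : ∀ n ω, α n ω =
      ∑' j : ℕ, (∏ s ∈ Finset.range j, W (n - (s : ℤ) * d) ω) * U (n - (j : ℤ) * d) ω)
    (S : ℤ → Ω → ℝ)
    (hS : ∀ n ω, S n ω = a n ω + (b n ω - a n ω) * α (n - d) ω) :
    ∀ n : ℤ, ∀ᵐ ω ∂ℙ,
      (S (n - d) ω ≤ r →
        S n ω = μ1 + e n ω + ∑ i ∈ Finset.Icc 1 q, φ i * e (n - i) ω) ∧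
      (r < S (n - d) ω →
        S n ω = μ2 + e n ω + ∑ i ∈ Finset.Icc 1 q, ψ i * e (n - i) ω) := by
  intro n
  let f : ℝ → (ℕ → ℝ) → (Fin (q + 1) → ℝ) → ℝ := fun μ θ x ↦
    μ + x 0 + ∑ i ∈ Finset.Icc 1 q, θ i * x (Fin.ofNat (q + 1) i)
  have hf (μ : ℝ) (θ : ℕ → ℝ) : Measurable (f μ θ) := by fun_prop
  have hwin (μ : ℝ) (θ : ℕ → ℝ) (k : ℤ) (ω : Ω) : f μ θ (fun i ↦ e (k - (i : ℕ)) ω) =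
      μ + e k ω + ∑ i ∈ Finset.Icc 1 q, θ i * e (k - i) ω := by
    simp only [f]
    congr 1
    · simp
    · refine sum_congr rfl fun i hi ↦ ?_
      rw [Fin.val_ofNat, Nat.mod_eq_of_lt (Nat.lt_succ_of_le (Finset.mem_Icc.1 hi).2)]
  let B : Set (Fin (q + 1) → ℝ) :=
    {x | f μ2 ψ x ≤ r ∧ f μ1 φ x ≤ r} ∪ {x | r < f μ2 ψ x ∧ r < f μ1 φ x}
  have hB : MeasurableSet B :=
    ((measurableSet_le (hf _ _) measurable_const).inter
      (measurableSet_le (hf _ _) measurable_const)).union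
    ((measurableSet_lt measurable_const (hf _ _)).inter
      (measurableSet_lt measurable_const (hf _ _)))
  have hmemB (k : ℤ) (ω : Ω) : (fun i : Fin (q + 1) ↦ e (k - (i : ℕ)) ω) ∈ B ↔
      (a k ω ≤ r ∧ b k ω ≤ r) ∨ (r < a k ω ∧ r < b k ω) := by
    simp only [B, Set.mem_union, Set.mem_ofPred_eq, hwin, ha, hb]
  have hpos : ℙ {ω | (fun i : Fin (q + 1) ↦ e (1 - (i : ℕ)) ω) ∈ B} ≠ 0 := fun h ↦ by
    simp only [hmemB, Set.ofPred_or, measure_union_null_iff] at h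
    exact hnd (by rw [h.1, h.2, add_zero])
  have hstep : q + 1 ≤ (q + 1) * d := Nat.le_mul_of_pos_right _ hd
  filter_upwards [ae_exists_window_mem he hindep hident hstep hB 1 hpos (n - d - d)] with ω hω
  obtain ⟨k, hk⟩ := hω
  have hzero : W (n - d - d - ((k * (q + 1) : ℕ) : ℤ) * d) ω = 0 := by
    rw [hmemB] at hk
    rw [hW]
    have hidx : n - d - d - ((k * (q + 1) : ℕ) : ℤ) * d =
        n - d - d - (k : ℤ) * ((q + 1) * d : ℕ) := by push_cast; ring
    rw [hidx]
    rcases hk with ⟨h₁, h₂⟩ | ⟨h₁, h₂⟩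
    · rw [if_pos h₁, if_pos h₂, sub_self]
    · rw [if_neg h₁.not_ge, if_neg h₂.not_ge, sub_self]
  have hα01 : α (n - d - d) ω = 0 ∨ α (n - d - d) ω = 1 := by
    rw [hα]
    refine tsum_prod_mul_eq_zero_or_one (w := fun s : ℕ ↦ W (n - d - d - (s : ℤ) * d) ω)
      (u := fun j : ℕ ↦ U (n - d - d - (j : ℤ) * d) ω) (fun j ↦ ?_) (fun j ↦ ?_) ⟨_, hzero⟩
    · simp only [hU]; split_ifs <;> simp
    · simp only [hU, hW]; split_ifs <;> simp
  have hrec : α (n - d) ω = U (n - d) ω + W (n - d) ω * α (n - d - d) ω := by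
    have hshift (j : ℕ) : n - d - ((j + 1 : ℕ) : ℤ) * d = n - d - d - (j : ℤ) * d := by
      push_cast; ring
    rw [hα, hα, tsum_prod_mul_eq_add (w := fun s : ℕ ↦ W (n - d - (s : ℤ) * d) ω)
      (fun j : ℕ ↦ U (n - d - (j : ℤ) * d) ω)
      ⟨k * (q + 1) + 1, by rw [hshift]; exact hzero⟩]
    simp only [hshift, Nat.cast_zero, zero_mul, sub_zero]
  rw [← ha, ← hb, hS n, hS (n - d), hrec, hU, hW]
  rcases hα01 with h | h <;> rw [h]
  · by_cases h' : a (n - d) ω ≤ r <;> simp [h', lt_of_not_ge]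
  · by_cases h' : b (n - d) ω ≤ r <;> simp [h', lt_of_not_ge]
end
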